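/- (Intrinsic catenaries, normal-vector characterization.) Let γ(t) = Ψ(u(t), v(t)) be a nondegenerate curve on [a,b] with u(t) > 0 and u(t) + λ ≠ 0 for all t, and let V be the vector field on S₁² defined by V(Ψ(u,v)) = (sinh(u) cos(v), sinh(u) sin(v), cosh(u)). Then γ is a critical point of the energy with density ρ(u,v) = u + λ (an intrinsic catenary with respect to the geodesic L = S₁² ∩ {z = 0}) if and only if its geodesic curvature satisfies κ(t) = ⟨n(t), V(γ(t))⟩ / ( d(t) + λ ) for all t, where n is the principal normal of γ and d(t) = u(t) is the intrinsic distance of γ(t) to L. -/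

import Mathlib

noncomputable section

open Real

/-- Lorentzian inner product on `ℝ³`: `⟨p,q⟩ = p₁q₁ + p₂q₂ − p₃q₃`. -/
def lprod (p q : Fin 3 → ℝ) : ℝ := p 0 * q 0 + p 1 * q 1 - p 2 * q 2

/-- Determinant of the 3×3 matrix with rows `a`, `b`, `c`. -/
def det3 (a b c : Fin 3 → ℝ) : ℝ :=
  a 0 * (b 1 * c 2 - b 2 * c 1) - a 1 * (b 0 * c 2 - b 2 * c 0)
    + a 2 * (b 0 * c 1 - b 1 * c 0)

/-- Parametrization `Ψ` of the de Sitter plane `S₁² ⊂ L³`. -/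
def Psi (u v : ℝ) : Fin 3 → ℝ :=
  ![Real.cosh u * Real.cos v, Real.cosh u * Real.sin v, Real.sinh u]

/-- Lorentzian cross product, characterized by `lprod (lcross a b) c = det3 a b c`. -/
def lcross (a b : Fin 3 → ℝ) : Fin 3 → ℝ :=
  ![a 1 * b 2 - a 2 * b 1, a 2 * b 0 - a 0 * b 2, a 1 * b 0 - a 0 * b 1]

/-- The curve `t ↦ Ψ(u t, v t)`, restricted to `[a, b]`, is a critical point of the
energy `E[γ] = ∫ₐᵇ ρ(u(t), v(t)) |γ'(t)| dt` among variations fixing the endpoints. -/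
def IsCritical (ρ : ℝ → ℝ → ℝ) (ε : ℝ) (u v : ℝ → ℝ) (a b : ℝ) : Prop :=
  ∀ φ ψ : ℝ → ℝ, ContDiff ℝ (⊤ : ℕ∞) φ → ContDiff ℝ (⊤ : ℕ∞) ψ →
    φ a = 0 → φ b = 0 → ψ a = 0 → ψ b = 0 →
    deriv (fun s : ℝ => ∫ t in a..b,
      ρ (u t + s * φ t) (v t + s * ψ t) *
        Real.sqrt (ε * ((deriv v t + s * deriv ψ t) ^ 2 *
          Real.cosh (u t + s * φ t) ^ 2 - (deriv u t + s * deriv φ t) ^ 2))) 0 = 0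

open Set Filter Topology MeasureTheory

/-- Differentiation under the integral sign over a compact interval, when the partial derivative is
continuous on a neighbourhood of `{0} × [a, b]`. -/
theorem hasDerivAt_intervalIntegral_of_continuousOn {a b : ℝ} (hab : a ≤ b) {F F' : ℝ → ℝ → ℝ}
    {O : Set (ℝ × ℝ)} (hO : IsOpen O) (hsub : ∀ t ∈ Icc a b, ((0 : ℝ), t) ∈ O)
    (hF : ∀ s, Continuous (F s)) (hF' : ContinuousOn (fun p : ℝ × ℝ => F' p.1 p.2) O)
    (hderiv : ∀ s t, (s, t) ∈ O → HasDerivAt (fun x => F x t) (F' s t) s) :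
    HasDerivAt (fun s => ∫ t in a..b, F s t) (∫ t in a..b, F' 0 t) 0 := by
  obtain ⟨V, W, hV, -, h0V, hW, hVW⟩ :=
    generalized_tube_lemma (isCompact_singleton (x := (0 : ℝ))) (isCompact_Icc (a := a) (b := b)) hO
      (by rintro ⟨s, t⟩ ⟨rfl, ht⟩; exact hsub t ht)
  obtain ⟨δ, hδ, hδV⟩ := Metric.nhds_basis_closedBall.mem_iff.1 (hV.mem_nhds (h0V rfl))
  have hK : Metric.closedBall (0 : ℝ) δ ×ˢ Icc a b ⊆ O :=
    (prod_mono hδV hW).trans hVW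
  obtain ⟨M, hM⟩ := ((isCompact_closedBall (0 : ℝ) δ).prod isCompact_Icc).exists_bound_of_continuousOn
    (hF'.mono hK)
  have hF'0 : ContinuousOn (F' 0) (Icc a b) :=
    hF'.comp (f := fun t : ℝ => ((0 : ℝ), t)) (by fun_prop) hsub
  have hI : ∀ t ∈ uIoc a b, t ∈ Icc a b := fun t ht => by
    rw [uIoc_of_le hab] at ht; exact Ioc_subset_Icc_self ht
  refine (intervalIntegral.hasDerivAt_integral_of_dominated_loc_of_deriv_le
    (bound := fun _ => M) (Metric.closedBall_mem_nhds (0 : ℝ) hδ)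
    (Eventually.of_forall fun s => (hF s).aestronglyMeasurable)
    ((hF 0).intervalIntegrable _ _) ?_ ?_ intervalIntegrable_const ?_).2
  · rw [uIoc_of_le hab]
    exact (hF'0.mono Ioc_subset_Icc_self).aestronglyMeasurable measurableSet_Ioc
  · exact Eventually.of_forall fun t ht s hs => hM (s, t) ⟨hs, hI t ht⟩
  · exact Eventually.of_forall fun t ht s hs => hderiv s t (hK ⟨hs, hI t ht⟩)

/-- Fundamental lemma of the calculus of variations on a compact interval. -/
theorem eqOn_zero_of_forall_intervalIntegral_mul_eq_zero {a b : ℝ} (hab : a < b) {g : ℝ → ℝ}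
    (hg : ContinuousOn g (Icc a b))
    (h : ∀ φ : ℝ → ℝ, ContDiff ℝ (⊤ : ℕ∞) φ → φ a = 0 → φ b = 0 → ∫ t in a..b, g t * φ t = 0) :
    ∀ t ∈ Icc a b, g t = 0 := by
  have hae : ∀ᵐ t, t ∈ Ioo a b → g t = 0 := by
    refine isOpen_Ioo.ae_eq_zero_of_integral_contDiff_smul_eq_zero
      ((hg.mono Ioo_subset_Icc_self).locallyIntegrableOn measurableSet_Ioo) ?_
    intro φ hφ _ hsupp
    have hout : ∀ t, t ∉ Ioo a b → φ t = 0 := fun t ht =>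
      image_eq_zero_of_notMem_tsupport fun hm => ht (hsupp hm)
    have h1 := h φ hφ (hout a (by simp)) (hout b (by simp))
    rw [intervalIntegral.integral_of_le hab.le] at h1
    rw [← setIntegral_eq_integral_of_forall_compl_eq_zero (s := Ioc a b), ← h1]
    · simp only [smul_eq_mul, mul_comm]
    · intro t ht
      rw [hout t fun hm => ht (Ioo_subset_Ioc_self hm), zero_smul]
  refine Measure.eqOn_Icc_of_ae_eq volume hab.ne ?_ hg continuousOn_const
  rw [← restrict_Ioo_eq_restrict_Icc]
  exact (ae_restrict_iff' measurableSet_Ioo).2 hae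

theorem lprod_lcross (a b c : Fin 3 → ℝ) : lprod (lcross a b) c = det3 a b c := by
  simp [det3, lprod, lcross]
  ring

/-- Triple products of position and velocity of a curve in the de Sitter plane with its acceleration
and with the field `∂Ψ/∂u`, in the coordinates of `Psi`. -/
theorem det3_deriv_Psi {u v : ℝ → ℝ} (hu : ContDiff ℝ (⊤ : ℕ∞) u) (hv : ContDiff ℝ (⊤ : ℕ∞) v)
    {γ : ℝ → Fin 3 → ℝ} (hγ : ∀ t, γ t = Psi (u t) (v t)) (t : ℝ) :
    det3 (γ t) (deriv γ t) (deriv (deriv γ) t) =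
      cosh (u t) * (deriv v t * deriv (deriv u) t - deriv u t * deriv (deriv v) t)
        + deriv v t ^ 3 * cosh (u t) ^ 2 * sinh (u t)
        - 2 * deriv u t ^ 2 * deriv v t * sinh (u t) ∧
    det3 (γ t) (deriv γ t) ![sinh (u t) * cos (v t), sinh (u t) * sin (v t), cosh (u t)] =
      cosh (u t) * deriv v t := by
  have hu0 : ∀ t, HasDerivAt u (deriv u t) t := fun t =>
    (hu.differentiable (by simp) t).hasDerivAt
  have hv0 : ∀ t, HasDerivAt v (deriv v t) t := fun t =>
    (hv.differentiable (by simp) t).hasDerivAt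
  have hu1 : HasDerivAt (deriv u) (deriv (deriv u) t) t :=
    (((contDiff_infty_iff_deriv.1 hu).2).differentiable (by simp) t).hasDerivAt
  have hv1 : HasDerivAt (deriv v) (deriv (deriv v) t) t :=
    (((contDiff_infty_iff_deriv.1 hv).2).differentiable (by simp) t).hasDerivAt
  have hγ' : deriv γ = fun t =>
      ![sinh (u t) * deriv u t * cos (v t) + cosh (u t) * (-sin (v t) * deriv v t),
        sinh (u t) * deriv u t * sin (v t) + cosh (u t) * (cos (v t) * deriv v t),
        cosh (u t) * deriv u t] := by
    funext t
    refine HasDerivAt.deriv (hasDerivAt_pi.2 fun i => ?_)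
    obtain rfl : γ = fun t => Psi (u t) (v t) := funext hγ
    fin_cases i
    · exact (hu0 t).cosh.mul (hv0 t).cos
    · exact (hu0 t).cosh.mul (hv0 t).sin
    · exact (hu0 t).sinh
  have hγ'' : HasDerivAt (deriv γ)
      ![((cosh (u t) * deriv u t) * deriv u t + sinh (u t) * deriv (deriv u) t) * cos (v t)
          + sinh (u t) * deriv u t * (-sin (v t) * deriv v t)
          + (sinh (u t) * deriv u t * (-sin (v t) * deriv v t)
          + cosh (u t) * (-(cos (v t) * deriv v t) * deriv v t + -sin (v t) * deriv (deriv v) t)),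
        ((cosh (u t) * deriv u t) * deriv u t + sinh (u t) * deriv (deriv u) t) * sin (v t)
          + sinh (u t) * deriv u t * (cos (v t) * deriv v t)
          + (sinh (u t) * deriv u t * (cos (v t) * deriv v t)
          + cosh (u t) * ((-sin (v t) * deriv v t) * deriv v t + cos (v t) * deriv (deriv v) t)),
        (sinh (u t) * deriv u t) * deriv u t + cosh (u t) * deriv (deriv u) t] t := by
    rw [hγ']
    refine hasDerivAt_pi.2 fun i => ?_
    fin_cases i
    · exact (((hu0 t).sinh.mul hu1).mul (hv0 t).cos).add
        ((hu0 t).cosh.mul ((hv0 t).sin.neg.mul hv1))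
    · exact (((hu0 t).sinh.mul hu1).mul (hv0 t).sin).add
        ((hu0 t).cosh.mul ((hv0 t).cos.mul hv1))
    · exact (hu0 t).cosh.mul hu1
  have e1 : cos (v t) ^ 2 = 1 - sin (v t) ^ 2 := by linarith [sin_sq_add_cos_sq (v t)]
  have e2 : cosh (u t) ^ 2 = sinh (u t) ^ 2 + 1 := cosh_sq _
  rw [hγ''.deriv, hγ', hγ]
  constructor
  · simp [det3, Psi]
    grind
  · simp [det3, Psi]
    grind

/-- The Euler–Lagrange defect of the energy with density `u + lam` for a curve with coordinates
`(u, v)`, first derivatives `(u1, v1)` and second derivatives `(u2, v2)`: it is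
`(u + lam) κ - ⟨n, V⟩`. -/
def catenaryDefect (lam ε u u1 v1 u2 v2 : ℝ) : ℝ :=
  (u + lam) * (ε * (cosh u * (v1 * u2 - u1 * v2) + v1 ^ 3 * cosh u ^ 2 * sinh u
    - 2 * u1 ^ 2 * v1 * sinh u) / √(ε * (v1 ^ 2 * cosh u ^ 2 - u1 ^ 2)) ^ 3)
    + cosh u * v1 / √(ε * (v1 ^ 2 * cosh u ^ 2 - u1 ^ 2))

/-- First variation of the energy with density `u + lam`. -/
theorem hasDerivAt_energy {a b lam ε : ℝ} (hab : a < b) (hε : ε = 1 ∨ ε = -1)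
    {u u1 v1 u2 v2 φ ψ φ1 ψ1 : ℝ → ℝ}
    (hu : ∀ t, HasDerivAt u (u1 t) t)
    (hu1 : ∀ t, HasDerivAt u1 (u2 t) t) (hv1 : ∀ t, HasDerivAt v1 (v2 t) t)
    (hu2 : Continuous u2) (hv2 : Continuous v2)
    (hφ : ∀ t, HasDerivAt φ (φ1 t) t) (hψ : ∀ t, HasDerivAt ψ (ψ1 t) t)
    (hφ1 : Continuous φ1) (hψ1 : Continuous ψ1)
    (hφa : φ a = 0) (hφb : φ b = 0) (hψa : ψ a = 0) (hψb : ψ b = 0)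
    (hnd : ∀ t ∈ Icc a b, 0 < ε * (v1 t ^ 2 * cosh (u t) ^ 2 - u1 t ^ 2)) :
    HasDerivAt (fun s : ℝ => ∫ t in a..b, (u t + s * φ t + lam) *
        √(ε * ((v1 t + s * ψ1 t) ^ 2 * cosh (u t + s * φ t) ^ 2 - (u1 t + s * φ1 t) ^ 2)))
      (∫ t in a..b, ε * cosh (u t) * catenaryDefect lam ε (u t) (u1 t) (v1 t) (u2 t) (v2 t) *
        (v1 t * φ t - u1 t * ψ t)) 0 := by
  have cu : Continuous u := continuous_iff_continuousAt.2 fun t => (hu t).continuousAt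
  have cu1 : Continuous u1 := continuous_iff_continuousAt.2 fun t => (hu1 t).continuousAt
  have cv1 : Continuous v1 := continuous_iff_continuousAt.2 fun t => (hv1 t).continuousAt
  have cφ : Continuous φ := continuous_iff_continuousAt.2 fun t => (hφ t).continuousAt
  have cψ : Continuous ψ := continuous_iff_continuousAt.2 fun t => (hψ t).continuousAt
  let R : ℝ → ℝ → ℝ := fun s t =>
    ε * ((v1 t + s * ψ1 t) ^ 2 * cosh (u t + s * φ t) ^ 2 - (u1 t + s * φ1 t) ^ 2)
  let R' : ℝ → ℝ → ℝ := fun s t =>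
    ε * (2 * (v1 t + s * ψ1 t) * ψ1 t * cosh (u t + s * φ t) ^ 2
      + (v1 t + s * ψ1 t) ^ 2 * (2 * cosh (u t + s * φ t) * (sinh (u t + s * φ t) * φ t))
      - 2 * (u1 t + s * φ1 t) * φ1 t)
  let F' : ℝ → ℝ → ℝ := fun s t =>
    φ t * √(R s t) + (u t + s * φ t + lam) * (R' s t / (2 * √(R s t)))
  have cR : Continuous fun p : ℝ × ℝ => R p.1 p.2 := by fun_prop
  have cR' : Continuous fun p : ℝ × ℝ => R' p.1 p.2 := by fun_prop
  have hR' : ∀ s t, HasDerivAt (fun x => R x t) (R' s t) s := fun s t => by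
    have h1 : ∀ c d : ℝ, HasDerivAt (fun x : ℝ => c + x * d) d s := fun c d => by
      simpa using ((hasDerivAt_id s).mul_const d).const_add c
    have h2 := ((((h1 (v1 t) (ψ1 t)).pow 2).mul ((h1 (u t) (φ t)).cosh.pow 2)).sub
      ((h1 (u1 t) (φ1 t)).pow 2)).const_mul ε
    refine h2.congr_deriv ?_
    simp [R']
  have hR0 : ∀ t ∈ Icc a b, 0 < R 0 t := fun t ht => by simpa [R] using hnd t ht
  have hmain : HasDerivAt (fun s : ℝ => ∫ t in a..b, (u t + s * φ t + lam) * √(R s t))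
      (∫ t in a..b, F' 0 t) 0 := by
    refine hasDerivAt_intervalIntegral_of_continuousOn hab.le
      (O := {p : ℝ × ℝ | 0 < R p.1 p.2}) (isOpen_lt continuous_const cR) hR0 ?_ ?_ ?_
    · intro s
      have : Continuous (R s) := by fun_prop
      fun_prop
    · have h0 : ∀ p ∈ {p : ℝ × ℝ | 0 < R p.1 p.2}, 2 * √(R p.1 p.2) ≠ 0 := fun p hp =>
        (mul_pos two_pos (sqrt_pos.2 hp)).ne'
      have c1 : Continuous fun p : ℝ × ℝ => √(R p.1 p.2) := cR.sqrt
      exact (by fun_prop : Continuous fun p : ℝ × ℝ => φ p.2 * √(R p.1 p.2)).continuousOn.add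
        ((by fun_prop : Continuous fun p : ℝ × ℝ => u p.2 + p.1 * φ p.2 + lam).continuousOn.mul
          (cR'.continuousOn.div (by fun_prop) h0))
    · intro s t hst
      have h1 : HasDerivAt (fun x : ℝ => u t + x * φ t + lam) (φ t) s := by
        simpa using (((hasDerivAt_id s).mul_const (φ t)).const_add (u t)).add_const lam
      exact h1.mul ((hR' s t).sqrt (ne_of_gt hst))
  refine hmain.congr_deriv ?_
  let w : ℝ → ℝ := fun t => √(ε * (v1 t ^ 2 * cosh (u t) ^ 2 - u1 t ^ 2))
  have hw : ∀ t ∈ Icc a b, 0 < w t := fun t ht => sqrt_pos.2 (hnd t ht)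
  have cw : Continuous w := by fun_prop
  let J : ℝ → ℝ := fun t => catenaryDefect lam ε (u t) (u1 t) (v1 t) (u2 t) (v2 t)
  have cJ : ContinuousOn J (Icc a b) := by
    refine ContinuousOn.add (ContinuousOn.mul (by fun_prop) (ContinuousOn.div (by fun_prop)
      (cw.pow 3).continuousOn fun t ht => (pow_pos (hw t ht) 3).ne'))
      (ContinuousOn.div (by fun_prop) cw.continuousOn fun t ht => (hw t ht).ne')
  have cF'0 : ContinuousOn (F' 0) (Icc a b) := by
    have c1 : Continuous (R 0) := by fun_prop
    have c2 : Continuous (R' 0) := by fun_prop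
    exact ContinuousOn.add (by fun_prop) (ContinuousOn.mul (by fun_prop)
      (c2.continuousOn.div (by fun_prop) fun t ht => (mul_pos two_pos (sqrt_pos.2 (hR0 t ht))).ne'))
  have cG : ContinuousOn (fun t => ε * cosh (u t) * J t * (v1 t * φ t - u1 t * ψ t)) (Icc a b) :=
    ((by fun_prop : Continuous fun t => ε * cosh (u t)).continuousOn.mul cJ).mul (by fun_prop)
  have hIcc : uIcc a b = Icc a b := uIcc_of_le hab.le
  have iF : IntervalIntegrable (F' 0) volume a b := (hIcc ▸ cF'0).intervalIntegrable
  have iG : IntervalIntegrable (fun t => ε * cosh (u t) * J t * (v1 t * φ t - u1 t * ψ t))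
    volume a b := ContinuousOn.intervalIntegrable (by rw [hIcc]; exact cG)
  have hparts : ∫ t in a..b, (F' 0 t - ε * cosh (u t) * J t * (v1 t * φ t - u1 t * ψ t)) =
      (u b + lam) * ε * (v1 b * cosh (u b) ^ 2 * ψ b - u1 b * φ b) / w b
        - (u a + lam) * ε * (v1 a * cosh (u a) ^ 2 * ψ a - u1 a * φ a) / w a := by
    refine intervalIntegral.integral_eq_sub_of_hasDerivAt
      (f := fun t => (u t + lam) * ε * (v1 t * cosh (u t) ^ 2 * ψ t - u1 t * φ t) / w t)
      (fun t ht => ?_) (iF.sub iG)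
    rw [hIcc] at ht
    have hwt := hw t ht
    have hsq : w t ^ 2 = ε * (v1 t ^ 2 * cosh (u t) ^ 2 - u1 t ^ 2) := sq_sqrt (hnd t ht).le
    have hdw : HasDerivAt w (ε * (v1 t * v2 t * cosh (u t) ^ 2
        + v1 t ^ 2 * cosh (u t) * sinh (u t) * u1 t - u1 t * u2 t) / w t) t := by
      refine (HasDerivAt.sqrt (((((hv1 t).pow 2).mul ((hu t).cosh.pow 2)).sub
        ((hu1 t).pow 2)).const_mul ε) (hnd t ht).ne').congr_deriv ?_
      change _ / (2 * w t) = _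
      simp only [Pi.pow_apply, Nat.cast_ofNat]
      field_simp
      ring
    have hd := ((((hu t).add_const lam).mul_const ε).mul
      ((((hv1 t).mul ((hu t).cosh.pow 2)).mul (hψ t)).sub ((hu1 t).mul (hφ t)))).div hdw hwt.ne'
    refine hd.congr_deriv ?_
    have hRw : √(R 0 t) = w t := by simp [R, w]
    simp only [F', J, catenaryDefect, hRw, R', Pi.mul_apply, Pi.pow_apply, Pi.sub_apply,
      zero_mul, add_zero, Nat.cast_ofNat, Nat.add_one_sub_one, pow_one]
    change _ = _ - ε * cosh (u t) * ((u t + lam) * (_ / w t ^ 3) + cosh (u t) * v1 t / w t) * _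
    generalize w t = W at hwt hsq ⊢
    generalize cosh (u t) = C at hsq ⊢
    generalize sinh (u t) = S
    have hW : W ≠ 0 := hwt.ne'
    have hε2 : ε ^ 2 = 1 := by rcases hε with rfl | rfl <;> norm_num
    field_simp
    grind
  rw [intervalIntegral.integral_sub iF iG] at hparts
  simp only [hφa, hφb, hψa, hψb] at hparts
  simpa [sub_eq_zero] using hparts

theorem intrinsic_catenary_normal_characterization
    (a b lam : ℝ) (hab : a < b)
    (u v : ℝ → ℝ) (hu : ContDiff ℝ (⊤ : ℕ∞) u) (hv : ContDiff ℝ (⊤ : ℕ∞) v)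
    (ε : ℝ) (hε : ε = 1 ∨ ε = -1)
    (γ : ℝ → Fin 3 → ℝ) (hγ : ∀ t, γ t = Psi (u t) (v t))
    (sp : ℝ → ℝ)
    (hsp : ∀ t, sp t =
      Real.sqrt (ε * ((deriv v t) ^ 2 * Real.cosh (u t) ^ 2 - (deriv u t) ^ 2)))
    (hnd : ∀ t ∈ Set.Icc a b,
      0 < ε * ((deriv v t) ^ 2 * Real.cosh (u t) ^ 2 - (deriv u t) ^ 2))
    (κ : ℝ → ℝ)
    (hκ : ∀ t, κ t = ε * det3 (γ t) (deriv γ t) (deriv (deriv γ) t) / sp t ^ 3)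
    (n : ℝ → Fin 3 → ℝ) (hn : ∀ t, n t = (-(1 / sp t)) • lcross (γ t) (deriv γ t))
    (hd : ∀ t ∈ Set.Icc a b, 0 < u t)
    (hne : ∀ t ∈ Set.Icc a b, u t + lam ≠ 0) :
    IsCritical (fun x _ => x + lam) ε u v a b ↔
      ∀ t ∈ Set.Icc a b,
        κ t = lprod (n t) ![Real.sinh (u t) * Real.cos (v t),
            Real.sinh (u t) * Real.sin (v t), Real.cosh (u t)] / (u t + lam) := by
  have hu0 : ∀ t, HasDerivAt u (deriv u t) t := fun t =>
    (hu.differentiable (by simp) t).hasDerivAt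
  have hu' := (contDiff_infty_iff_deriv.1 hu).2
  have hv' := (contDiff_infty_iff_deriv.1 hv).2
  have hu1 : ∀ t, HasDerivAt (deriv u) (deriv (deriv u) t) t := fun t =>
    (hu'.differentiable (by simp) t).hasDerivAt
  have hv1 : ∀ t, HasDerivAt (deriv v) (deriv (deriv v) t) t := fun t =>
    (hv'.differentiable (by simp) t).hasDerivAt
  have cu2 : Continuous (deriv (deriv u)) := (contDiff_infty_iff_deriv.1 hu').2.continuous
  have cv2 : Continuous (deriv (deriv v)) := (contDiff_infty_iff_deriv.1 hv').2.continuous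
  have cu := hu.continuous
  have cu1 := hu'.continuous
  have cv1 := hv'.continuous
  set J : ℝ → ℝ := fun t =>
    catenaryDefect lam ε (u t) (deriv u t) (deriv v t) (deriv (deriv u) t) (deriv (deriv v) t)
    with hJ
  have cJ : ContinuousOn J (Icc a b) := by
    have hw : ∀ t ∈ Icc a b,
        √(ε * (deriv v t ^ 2 * cosh (u t) ^ 2 - deriv u t ^ 2)) ≠ 0 :=
      fun t ht => (sqrt_pos.2 (hnd t ht)).ne'
    exact ContinuousOn.add (ContinuousOn.mul (by fun_prop) (ContinuousOn.div (by fun_prop)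
      (by fun_prop) fun t ht => pow_ne_zero 3 (hw t ht)))
      (ContinuousOn.div (by fun_prop) (by fun_prop) hw)
  have hε0 : ε ≠ 0 := by rcases hε with rfl | rfl <;> norm_num
  have hcrit : IsCritical (fun x _ => x + lam) ε u v a b ↔
      ∀ φ ψ : ℝ → ℝ, ContDiff ℝ (⊤ : ℕ∞) φ → ContDiff ℝ (⊤ : ℕ∞) ψ →
        φ a = 0 → φ b = 0 → ψ a = 0 → ψ b = 0 →
        ∫ t in a..b, ε * cosh (u t) * J t * (deriv v t * φ t - deriv u t * ψ t) = 0 := by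
    unfold IsCritical
    refine forall₄_congr fun φ ψ hφ hψ => forall₄_congr fun hφa hφb hψa hψb => ?_
    rw [(hasDerivAt_energy hab hε hu0 hu1 hv1 cu2 cv2
      (fun t => (hφ.differentiable (by simp) t).hasDerivAt)
      (fun t => (hψ.differentiable (by simp) t).hasDerivAt)
      (contDiff_infty_iff_deriv.1 hφ).2.continuous (contDiff_infty_iff_deriv.1 hψ).2.continuous
      hφa hφb hψa hψb hnd).deriv]
  have hzero : IsCritical (fun x _ => x + lam) ε u v a b ↔ ∀ t ∈ Icc a b, J t = 0 := by
    rw [hcrit]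
    constructor
    · intro h t ht
      have h1 := eqOn_zero_of_forall_intervalIntegral_mul_eq_zero hab
        (g := fun t => ε * cosh (u t) * J t * deriv v t)
        (((by fun_prop : ContinuousOn (fun t => ε * cosh (u t)) (Icc a b)).mul cJ).mul
          (by fun_prop))
        (fun φ hφ hφa hφb => by
          simpa [mul_assoc] using h φ 0 hφ contDiff_const hφa hφb rfl rfl) t ht
      have h2 := eqOn_zero_of_forall_intervalIntegral_mul_eq_zero hab
        (g := fun t => ε * cosh (u t) * J t * deriv u t)
        (((by fun_prop : ContinuousOn (fun t => ε * cosh (u t)) (Icc a b)).mul cJ).mul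
          (by fun_prop))
        (fun ψ hψ hψa hψb => by
          simpa [mul_assoc] using h 0 ψ contDiff_const hψ rfl rfl hψa hψb) t ht
      by_contra hJt
      have hc : ε * cosh (u t) * J t ≠ 0 := mul_ne_zero (mul_ne_zero hε0 (cosh_pos _).ne') hJt
      have h3 := hnd t ht
      rw [(mul_eq_zero.1 h1).resolve_left hc, (mul_eq_zero.1 h2).resolve_left hc] at h3
      simp at h3
    · intro h φ ψ _ _ _ _ _ _
      rw [intervalIntegral.integral_congr (g := fun _ => 0), intervalIntegral.integral_zero]
      intro t ht
      rw [uIcc_of_le hab.le] at ht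
      simp [h t ht]
  rw [hzero]
  refine forall₂_congr fun t ht => ?_
  obtain ⟨hacc, hfield⟩ := det3_deriv_Psi hu hv hγ t
  have hsmul : ∀ (c : ℝ) (p q : Fin 3 → ℝ), lprod (c • p) q = c * lprod p q := fun c p q => by
    simp only [lprod, Pi.smul_apply, smul_eq_mul]
    ring
  rw [hκ, hn, hsmul, lprod_lcross, hfield, hacc, eq_div_iff (hne t ht), hJ]
  simp only [catenaryDefect, ← hsp]
  constructor <;> intro h <;> linear_combination h
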